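/- Let b ≥ 2 be even and let S be the concatenation of all 2^b binary strings of length b in lexicographic order. The greedy LZ77 parsing of S produces O(2^b) phrases; more precisely, there exists an LZ-like parsing of S with at most 3·2^b + b phrases, where each b-bit block a_1⋯a_{k-1}1 0^{b-k} (following block a_1⋯a_{k-1}0 1^{b-k}) parses into at most 3 phrases. -/

import Mathlib

/-- Start position (0-based) of the `j`-th phrase of a parsing. -/
def phraseStart {α : Type*} (P : List (List α)) (j : ℕ) : ℕ := ((P.take j).flatten).length

/-- An LZ-like parsing of `T`: a factorization into non-empty phrases where each
phrase is a single symbol or has an occurrence in `T` starting strictly before it. -/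
def IsLZLike {α : Type*} (T : List α) (P : List (List α)) : Prop :=
  T = P.flatten ∧ (∀ Q ∈ P, Q ≠ []) ∧
  ∀ j, j < P.length →
    (P.getD j []).length = 1 ∨
    ∃ p, p < phraseStart P j ∧ (T.drop p).take (P.getD j []).length = P.getD j []

/-- The greedy LZ77 parsing: an LZ-like parsing in which no phrase can be extended,
i.e., no strictly longer prefix of the remaining suffix has an earlier occurrence. -/
def IsGreedyLZ {α : Type*} (T : List α) (P : List (List α)) : Prop :=
  IsLZLike T P ∧
  ∀ j, j < P.length → ∀ L, (P.getD j []).length < L →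
    phraseStart P j + L ≤ T.length →
    ¬ ∃ p, p < phraseStart P j ∧
      (T.drop p).take L = (T.drop (phraseStart P j)).take L

/-- The Relative Lempel--Ziv parsing of `T` with reference `R`: each phrase is the
longest prefix of the remaining suffix occurring as a substring of `R`, or a literal. -/
def IsRLZ {α : Type*} (R T : List α) (P : List (List α)) : Prop :=
  T = P.flatten ∧ (∀ Q ∈ P, Q ≠ []) ∧
  (∀ j, j < P.length → (P.getD j []).length = 1 ∨ (P.getD j []) <:+: R) ∧
  ∀ j, j < P.length → ∀ L, (P.getD j []).length < L →
    phraseStart P j + L ≤ T.length →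
    ¬ ((T.drop (phraseStart P j)).take L <:+: R)

/-- The concatenation of all `2^b` binary strings of length `b` in lexicographic
(increasing numeric) order, most significant bit first. -/
def lexConcat (b : ℕ) : List Bool :=
  ((List.range (2 ^ b)).map (fun q => (List.range b).map (fun r => q.testBit (b - 1 - r)))).flatten

theorem phraseStart_zero {α : Type*} (P : List (List α)) : phraseStart P 0 = 0 := by
  simp [phraseStart]

theorem phraseStart_succ {α : Type*} (P : List (List α)) {j : ℕ} (hj : j < P.length) :
    phraseStart P (j + 1) = phraseStart P j + (P.getD j []).length := by
  rw [phraseStart, phraseStart, List.take_succ_eq_append_getElem hj, List.getD_eq_getElem _ _ hj]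
  simp only [List.flatten_append, List.length_append, List.flatten_singleton]

theorem phraseStart_append_of_le {α : Type*} (P P' : List (List α)) {j : ℕ}
    (hj : j ≤ P.length) : phraseStart (P ++ P') j = phraseStart P j := by
  simp only [phraseStart, List.take_append_of_le_length hj]

theorem phraseStart_length {α : Type*} (P : List (List α)) :
    phraseStart P P.length = P.flatten.length := by
  simp only [phraseStart, List.take_length]

theorem flatten_drop_phraseStart_take {α : Type*} (P : List (List α)) {j : ℕ}
    (hj : j < P.length) :
    (P.flatten.drop (phraseStart P j)).take (P.getD j []).length = P.getD j [] := by
  have h : P.flatten = (P.take j).flatten ++ (P.getD j [] ++ (P.drop (j + 1)).flatten) := by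
    conv_lhs => rw [← List.take_append_drop j P, List.drop_eq_getElem_cons hj]
    rw [List.flatten_append, List.flatten_cons, List.getD_eq_getElem _ _ hj]
  conv_lhs => rw [h, phraseStart, List.drop_left, List.take_left]

theorem phraseStart_le_length {α : Type*} (P : List (List α)) (j : ℕ) :
    phraseStart P j ≤ P.flatten.length := by
  conv_rhs => rw [← List.take_append_drop j P, List.flatten_append, List.length_append]
  exact Nat.le_add_right _ _

/-- The greedy parsing is always at least as far advanced as any other LZ-like parsing. -/
theorem IsGreedyLZ.phraseStart_le {α : Type*} {T : List α} {Z P : List (List α)}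
    (hZ : IsGreedyLZ T Z) (hP : IsLZLike T P) (j : ℕ) (hjP : j ≤ P.length)
    (hjZ : j ≤ Z.length) : phraseStart P j ≤ phraseStart Z j := by
  induction j with
  | zero => simp [phraseStart_zero]
  | succ j ih =>
    have ih := ih (by omega) (by omega)
    have hlast := phraseStart_le_length P (j + 1)
    rw [← hP.1] at hlast
    have hZne : 0 < (Z.getD j []).length := by
      apply List.length_pos_of_ne_nil
      apply hZ.1.2.1
      rw [List.getD_eq_getElem _ _ (by omega)]
      exact List.getElem_mem _
    have hself := flatten_drop_phraseStart_take P (show j < P.length by omega)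
    rw [← hP.1] at hself
    rw [phraseStart_succ P (by omega)] at hlast ⊢
    rw [phraseStart_succ Z (by omega)]
    by_contra! hlt
    rcases hP.2.2 j (by omega) with h1 | ⟨p, hp, hcopy⟩
    · omega
    · set s := phraseStart P j
      set z := phraseStart Z j
      set n := (P.getD j []).length
      refine hZ.2 j (by omega) (s + n - z) (by omega) (by omega) ⟨p + (z - s), by omega, ?_⟩
      have h := congrArg (List.drop (z - s)) (hcopy.trans hself.symm)
      rw [List.drop_take, List.drop_take, List.drop_drop, List.drop_drop] at h
      rwa [show n - (z - s) = s + n - z by omega, show s + (z - s) = z by omega] at h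

/-- The greedy parsing has the fewest phrases among all LZ-like parsings. -/
theorem IsGreedyLZ.length_le {α : Type*} {T : List α} {Z P : List (List α)}
    (hZ : IsGreedyLZ T Z) (hP : IsLZLike T P) : Z.length ≤ P.length := by
  by_contra! hlt
  have h1 := hZ.phraseStart_le hP P.length le_rfl hlt.le
  have h2 := phraseStart_le_length Z (P.length + 1)
  have hZne : 0 < (Z.getD P.length []).length := by
    apply List.length_pos_of_ne_nil
    apply hZ.1.2.1
    rw [List.getD_eq_getElem _ _ hlt]
    exact List.getElem_mem _
  rw [phraseStart_length, ← hP.1] at h1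
  rw [phraseStart_succ Z hlt, ← hZ.1.1] at h2
  omega

theorem IsLZLike.append_phrase {α : Type*} {T Q : List α} {P : List (List α)}
    (hP : IsLZLike T P) (hne : Q ≠ []) (hQ : Q.length = 1 ∨ Q <:+: T) :
    IsLZLike (T ++ Q) (P ++ [Q]) := by
  obtain ⟨hT, hnil, hocc⟩ := hP
  refine ⟨by simp [hT], ?_, fun j hj => ?_⟩
  · intro R hR
    rcases List.mem_append.1 hR with h | h
    · exact hnil R h
    · rwa [List.mem_singleton.1 h]
  · rw [List.length_append, List.length_singleton] at hj
    rw [phraseStart_append_of_le P [Q] (by omega)]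
    rcases Nat.lt_succ_iff_lt_or_eq.1 hj with hj | rfl
    · rw [List.getD_append _ _ _ _ hj]
      refine (hocc j hj).imp_right fun ⟨p, hp, h⟩ => ⟨p, hp, ?_⟩
      have hlen := congrArg List.length h
      have hle : phraseStart P j ≤ T.length := hT ▸ phraseStart_le_length P j
      rw [List.length_take] at hlen
      rw [List.drop_append_of_le_length (by omega), List.take_append_of_le_length (by omega), h]
    · rw [List.getD_append_right _ _ _ _ le_rfl, phraseStart_length, ← hT]
      simp only [Nat.sub_self, List.getD_cons_zero]
      refine hQ.imp_right fun ⟨u, v, h⟩ => ⟨u.length, ?_, ?_⟩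
      · have := List.length_pos_of_ne_nil hne
        rw [← h]
        simp only [List.length_append]
        omega
      · rw [← h]
        simp

/-- `T` has an LZ-like parsing with at most `n` phrases. -/
def HasLZLike {α : Type*} (T : List α) (n : ℕ) : Prop :=
  ∃ P, IsLZLike T P ∧ P.length ≤ n

theorem HasLZLike.append {α : Type*} {T Q : List α} {n : ℕ} (h : HasLZLike T n)
    (hQ : Q.length = 1 ∨ Q <:+: T) : HasLZLike (T ++ Q) (n + 1) := by
  obtain ⟨P, hP, hn⟩ := h
  rcases eq_or_ne Q [] with rfl | hne
  · exact ⟨P, by simpa using hP, by omega⟩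
  · exact ⟨P ++ [Q], hP.append_phrase hne hQ, by simpa using hn⟩

theorem hasLZLike_replicate {α : Type*} (a : α) (n : ℕ) : HasLZLike (List.replicate n a) n := by
  induction n with
  | zero => exact ⟨[], by simp [IsLZLike], by simp⟩
  | succ n ih =>
    rw [List.replicate_succ']
    exact ih.append (Or.inl rfl)

/-- The `b`-bit binary representation of `q`, most significant bit first. -/
def bitBlock (b q : ℕ) : List Bool := (List.range b).map fun r => q.testBit (b - 1 - r)

theorem bitBlock_succ (b q : ℕ) : bitBlock (b + 1) q = bitBlock b (q / 2) ++ [q.testBit 0] := by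
  simp only [bitBlock, List.range_succ, List.map_append, List.map_singleton]
  congr 1
  · refine List.map_congr_left fun r hr => ?_
    rw [List.mem_range] at hr
    rw [← Nat.testBit_succ]
    congr 1
    omega
  · simp

theorem bitBlock_zero_right (b : ℕ) : bitBlock b 0 = List.replicate b false := by
  simp [bitBlock, List.map_const']

/-- Binary increment: a common prefix, then a one, then only zeros. -/
theorem exists_bitBlock_add_one (b n : ℕ) (hn : n + 1 < 2 ^ b) :
    ∃ A B m, m ≤ b ∧ bitBlock b n = A ++ B ∧
      bitBlock b (n + 1) = A ++ [true] ++ List.replicate m false := by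
  induction b generalizing n with
  | zero => simp at hn
  | succ b ih =>
    rw [pow_succ] at hn
    rcases Nat.even_or_odd' n with ⟨k, rfl | rfl⟩
    · refine ⟨bitBlock b k, [false], 0, by omega, ?_, ?_⟩
      · rw [bitBlock_succ, show 2 * k / 2 = k by omega]
        simp
      · rw [bitBlock_succ, show (2 * k + 1) / 2 = k by omega]
        simp
    · obtain ⟨A, B, m, hm, h1, h2⟩ := ih k (by omega)
      refine ⟨A, B ++ [true], m + 1, by omega, ?_, ?_⟩
      · rw [bitBlock_succ, show (2 * k + 1) / 2 = k by omega, h1]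
        simp
      · rw [bitBlock_succ, show (2 * k + 1 + 1) / 2 = k + 1 by omega, h2,
          show 2 * k + 1 + 1 = 2 * (k + 1) by ring, List.replicate_succ']
        simp

theorem hasLZLike_bitBlocks (b n : ℕ) (hn : n < 2 ^ b) :
    HasLZLike ((List.range (n + 1)).map (bitBlock b)).flatten (b + 3 * n) := by
  induction n with
  | zero => simpa [bitBlock_zero_right] using hasLZLike_replicate false b
  | succ n ih =>
    obtain ⟨A, B, m, hm, hprev, hnext⟩ := exists_bitBlock_add_one b n hn
    set C := ((List.range (n + 1)).map (bitBlock b)).flatten with hC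
    have hmem : ∀ q ≤ n, bitBlock b q <:+: C := fun q hq =>
      List.infix_of_mem_flatten (List.mem_map_of_mem (List.mem_range.2 (by omega)))
    have hA : A <:+: C := (hprev ▸ (List.prefix_append A B).isInfix).trans (hmem n le_rfl)
    have hzeros : List.replicate m false <:+: C := by
      refine List.IsInfix.trans ?_ (hmem 0 n.zero_le)
      rw [bitBlock_zero_right, ← Nat.add_sub_cancel' hm, List.replicate_add]
      exact (List.prefix_append _ _).isInfix
    have h := (((ih (by omega)).append (Or.inr hA)).append
      (Or.inl (List.length_singleton (a := true)))).append
      (Or.inr (hzeros.trans ((List.prefix_append C (A ++ [true])).isInfix.trans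
        (by rw [List.append_assoc]))))
    rw [List.range_succ, List.map_append, List.flatten_append, ← hC]
    simpa [hnext, Nat.mul_add, ← add_assoc] using h

theorem hasLZLike_lexConcat (b : ℕ) : HasLZLike (lexConcat b) (3 * 2 ^ b + b) := by
  have hpos : 0 < 2 ^ b := by positivity
  obtain ⟨P, hP, hlen⟩ := hasLZLike_bitBlocks b (2 ^ b - 1) (by omega)
  rw [Nat.sub_add_cancel hpos] at hP
  exact ⟨P, hP, by omega⟩

theorem lz_of_lexConcat (b : ℕ) (hb : 2 ≤ b) (heven : Even b) :
    (∃ P, IsLZLike (lexConcat b) P ∧ P.length ≤ 3 * 2 ^ b + b) ∧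
    ∀ Z, IsGreedyLZ (lexConcat b) Z → Z.length ≤ 3 * 2 ^ b + b := by
  obtain ⟨P, hP, hlen⟩ := hasLZLike_lexConcat b
  exact ⟨⟨P, hP, hlen⟩, fun Z hZ => (hZ.length_le hP).trans hlen⟩
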